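/- Let E_1,…,E_r be CPTP maps on the d×d complex matrices, let A_i = fix(E_i), and let Â = ⋂_{i=1}^r A_i. For a set S of matrices, let supp(S) denote the smallest subspace of ℂ^d containing the range of every positive semidefinite element of S. Assume Â contains a density matrix and that supp(Â) = ⋂_{i=1}^r supp(A_i). Then there exist CPTP projections Ê_1,…,Ê_r with fix(Ê_i) = A_i for each i, such that for every density matrix τ the cyclic iterates (Ê_r∘⋯∘Ê_1)^n(τ) converge as n → ∞ to Ê(τ), where Ê is a CPTP projection with fix(Ê) = Â. -/

import Mathlib

open Matrix Filter
open scoped ComplexOrder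

/-- A map on `d × d` complex matrices is CPTP if it admits a Kraus (operator-sum)
representation `E(X) = ∑ k, M k * X * (M k)ᴴ` with `∑ k, (M k)ᴴ * M k = 1`. -/
def IsCPTP {d : ℕ} (E : Matrix (Fin d) (Fin d) ℂ → Matrix (Fin d) (Fin d) ℂ) : Prop :=
  ∃ (m : ℕ) (M : Fin m → Matrix (Fin d) (Fin d) ℂ),
    (∀ X, E X = ∑ k, M k * X * (M k)ᴴ) ∧ (∑ k, (M k)ᴴ * M k = 1)

/-- A density matrix: positive semidefinite with trace one. -/
def IsDensity {d : ℕ} (ρ : Matrix (Fin d) (Fin d) ℂ) : Prop :=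
  ρ.PosSemidef ∧ ρ.trace = 1

/-- The support of a set `S` of matrices: the smallest subspace of `ℂ^d` containing the
range of every positive semidefinite element of `S`. -/
noncomputable def suppOfSet {d : ℕ} (S : Set (Matrix (Fin d) (Fin d) ℂ)) : Submodule ℂ (Fin d → ℂ) :=
  ⨆ A ∈ {A ∈ S | Matrix.PosSemidef A}, LinearMap.range (Matrix.mulVecLin A)

/-- One cycle of the maps `F 0, F 1, …, F (r-1)` (applied in this order), i.e.
`E_r ∘ ⋯ ∘ E_1` when `E_j = F (j-1)`. -/
def cycleOf {α : Type*} {r : ℕ} (F : Fin r → (α → α)) : α → α :=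
  fun x => (List.ofFn F).foldl (fun y f => f y) x


namespace FPS

abbrev Mat (d : ℕ) := Matrix (Fin d) (Fin d) ℂ

open scoped MatrixOrder Matrix.Norms.L2Operator in
lemma psd_factor {n : Type*} [Fintype n] [DecidableEq n] {A : Matrix n n ℂ} (hA : A.PosSemidef) :
    ∃ B : Matrix n n ℂ, A = Bᴴ * B := by
  obtain ⟨B, rfl⟩ := CStarAlgebra.nonneg_iff_eq_star_mul_self.mp hA.nonneg
  exact ⟨B, rfl⟩

lemma psd_mul_eq_zero {d : ℕ} {A K : Mat d} (hA : A.PosSemidef)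
    (h : (K * A * Kᴴ).trace = 0) : K * A = 0 := by
  obtain ⟨B, rfl⟩ := psd_factor hA
  have h2 : (B * Kᴴ) = 0 := by
    rw [← Matrix.trace_conjTranspose_mul_self_eq_zero_iff]
    simpa [Matrix.mul_assoc] using h
  have h3 : K * Bᴴ = 0 := by
    simpa using congrArg Matrix.conjTranspose h2
  rw [← Matrix.mul_assoc, h3, Matrix.zero_mul]

/-- `P` is the support projection of `ρ` and `R` its pseudo-inverse. -/
structure Supp {d : ℕ} (ρ P R : Mat d) : Prop where
  herm : Pᴴ = P
  idem : P * P = P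
  Pρ : P * ρ = ρ
  ρP : ρ * P = ρ
  ρR : ρ * R = P
  Rρ : R * ρ = P
  PR : P * R = R
  RP : R * P = R
  Rpsd : R.PosSemidef

lemma exists_supp {d : ℕ} {ρ : Mat d} (hρ : ρ.PosSemidef) : ∃ P R, Supp ρ P R := by
  have hs := hρ.1.spectral_theorem
  rw [Unitary.conjStarAlgAut_apply] at hs
  set U : Mat d := (hρ.1.eigenvectorUnitary : Mat d) with hU
  have hUU : Uᴴ * U = 1 := Unitary.coe_star_mul_self hρ.1.eigenvectorUnitary
  set l := hρ.1.eigenvalues with hl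
  have hl0 : ∀ i, 0 ≤ l i := hρ.eigenvalues_nonneg
  let D : (Fin d → ℂ) → Mat d := fun f => U * Matrix.diagonal f * Uᴴ
  have hD : ∀ f g, D f * D g = D (f * g) := by
    intro f g
    have : D f * D g = U * Matrix.diagonal f * (Uᴴ * U) * Matrix.diagonal g * Uᴴ := by
      simp only [D, Matrix.mul_assoc]
    rw [this, hUU, Matrix.mul_one, Matrix.mul_assoc U, Matrix.diagonal_mul_diagonal]
    rfl
  have hρD : ρ = D (fun i => (l i : ℂ)) := hs
  have hDH : ∀ f, (D f)ᴴ = D (star f) := by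
    intro f
    simp [D, Matrix.mul_assoc, Matrix.diagonal_conjTranspose]
  refine ⟨D (fun i => if l i = 0 then 0 else 1), D (fun i => ((l i)⁻¹ : ℂ)), ?_, ?_, ?_, ?_, ?_, ?_, ?_, ?_, ?_⟩
  · rw [hDH]; congr 1; ext i; by_cases h : l i = 0 <;> simp [h]
  · rw [hD]; congr 1; ext i; by_cases h : l i = 0 <;> simp [h]
  · rw [hρD, hD]; congr 1; ext i; by_cases h : l i = 0 <;> simp [h]
  · rw [hρD, hD]; congr 1; ext i; by_cases h : l i = 0 <;> simp [h]
  · rw [hρD, hD]; congr 1; ext i; by_cases h : l i = 0 <;> simp [h]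
  · rw [hρD, hD]; congr 1; ext i; by_cases h : l i = 0 <;> simp [h]
  · rw [hD]; congr 1; ext i; by_cases h : l i = 0 <;> simp [h]
  · rw [hD]; congr 1; ext i; by_cases h : l i = 0 <;> simp [h]
  · apply Matrix.PosSemidef.mul_mul_conjTranspose_same
    apply Matrix.PosSemidef.diagonal
    intro i
    have := inv_nonneg.mpr (hl0 i)
    simp only [Pi.zero_apply]
    exact_mod_cast this

lemma psd_range_le {d : ℕ} {A B : Mat d} (hA : A.PosSemidef) (hB : B.PosSemidef) :
    LinearMap.range (Matrix.mulVecLin A) ≤ LinearMap.range (Matrix.mulVecLin (A + B)) := by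
  obtain ⟨P, R, h⟩ := exists_supp (hA.add hB)
  have h1 : (1 - P) * (A + B) * (1 - P)ᴴ = 0 := by
    rw [Matrix.sub_mul, h.Pρ]; simp
  have h2 : ((1 - P) * A * (1 - P)ᴴ).trace + ((1 - P) * B * (1 - P)ᴴ).trace = 0 := by
    rw [← Matrix.trace_add, ← Matrix.add_mul, ← Matrix.mul_add, h1, Matrix.trace_zero]
  have h3 : ((1 - P) * A * (1 - P)ᴴ).trace = 0 :=
    ((add_eq_zero_iff_of_nonneg (hA.mul_mul_conjTranspose_same _).trace_nonneg
      (hB.mul_mul_conjTranspose_same _).trace_nonneg).mp h2).1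
  have h4 := psd_mul_eq_zero hA h3
  have h5 : A = (A + B) * (R * A) := by
    rw [← Matrix.mul_assoc, h.ρR]
    rw [Matrix.sub_mul, Matrix.one_mul, sub_eq_zero] at h4
    exact h4
  rintro _ ⟨v, rfl⟩
  refine ⟨(R * A) *ᵥ v, ?_⟩
  simp only [Matrix.mulVecLin_apply, Matrix.mulVec_mulVec]
  rw [← h5]

lemma exists_max {d : ℕ} {S : Set (Mat d)} (h0 : (0 : Mat d) ∈ S)
    (hadd : ∀ A ∈ S, ∀ B ∈ S, A + B ∈ S) :
    ∃ ρ ∈ S, ρ.PosSemidef ∧ LinearMap.range (Matrix.mulVecLin ρ) = suppOfSet S := by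
  classical
  let p : ℕ → Prop := fun n => ∃ A ∈ S, A.PosSemidef ∧
    Module.finrank ℂ (LinearMap.range (Matrix.mulVecLin A)) = n
  have hb : ∀ n, p n → n ≤ d := by
    rintro n ⟨A, _, _, rfl⟩
    simpa using Submodule.finrank_le (LinearMap.range (Matrix.mulVecLin A))
  have hp : ∃ n, p n := ⟨_, 0, h0, Matrix.PosSemidef.zero, rfl⟩
  obtain ⟨n0, hn0⟩ := hp
  obtain ⟨ρ, hρS, hρ, hρn⟩ := Nat.findGreatest_spec (hb n0 hn0) hn0
  refine ⟨ρ, hρS, hρ, le_antisymm ?_ ?_⟩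
  · exact le_iSup₂_of_le ρ ⟨hρS, hρ⟩ le_rfl
  · refine iSup₂_le ?_
    rintro B ⟨hBS, hB⟩
    have hpn : p (Module.finrank ℂ (LinearMap.range (Matrix.mulVecLin (ρ + B)))) :=
      ⟨_, hadd _ hρS _ hBS, hρ.add hB, rfl⟩
    have h1 := Nat.le_findGreatest (hb _ hpn) hpn
    rw [← hρn] at h1
    have h2 := Submodule.eq_of_le_of_finrank_le (psd_range_le hρ hB) h1
    rw [h2, add_comm]
    exact psd_range_le hB hρ

lemma supp_mul_of_range_le {d : ℕ} {ρ P R X : Mat d} (h : Supp ρ P R)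
    (hX : ∀ v, X *ᵥ v ∈ LinearMap.range (Matrix.mulVecLin ρ)) : P * X = X := by
  apply Matrix.ext_of_mulVec_single
  intro i
  obtain ⟨w, hw⟩ := hX (Pi.single i 1)
  rw [← Matrix.mulVec_mulVec, ← hw]
  simp only [Matrix.mulVecLin_apply, Matrix.mulVec_mulVec, h.Pρ]

lemma range_of_supp_mul {d : ℕ} {ρ P R X : Mat d} (h : Supp ρ P R)
    (hX : P * X = X) (v) : X *ᵥ v ∈ LinearMap.range (Matrix.mulVecLin ρ) := by
  refine ⟨(R * X) *ᵥ v, ?_⟩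
  simp only [Matrix.mulVecLin_apply, Matrix.mulVec_mulVec]
  rw [← Matrix.mul_assoc, h.ρR, hX]

lemma isCPTP_of_fintype {d : ℕ} {ι : Type*} [Fintype ι] {E : Mat d → Mat d} (M : ι → Mat d)
    (h1 : ∀ X, E X = ∑ k, M k * X * (M k)ᴴ) (h2 : ∑ k, (M k)ᴴ * M k = 1) : IsCPTP E := by
  let e := Fintype.equivFin ι
  refine ⟨Fintype.card ι, fun k => M (e.symm k), fun X => ?_, ?_⟩
  · rw [h1, ← e.symm.sum_comp]
  · rw [← h2, ← e.symm.sum_comp]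

lemma cptp_id {d : ℕ} : IsCPTP (id : Mat d → Mat d) :=
  ⟨1, fun _ => 1, by simp, by simp⟩

lemma cptp_comp {d : ℕ} {E F : Mat d → Mat d} (hE : IsCPTP E) (hF : IsCPTP F) :
    IsCPTP (E ∘ F) := by
  obtain ⟨m, M, hM, hM1⟩ := hE
  obtain ⟨n, N, hN, hN1⟩ := hF
  refine isCPTP_of_fintype (ι := Fin m × Fin n) (fun p => M p.1 * N p.2) (fun X => ?_) ?_
  · simp only [Function.comp, hM, hN, Fintype.sum_prod_type, Matrix.conjTranspose_mul,
      Matrix.mul_sum, Matrix.sum_mul, Matrix.mul_assoc]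
  · rw [Fintype.sum_prod_type_right]
    have : ∀ y, ∑ x, (M x * N y)ᴴ * (M x * N y) = (N y)ᴴ * N y := by
      intro y
      calc ∑ x, (M x * N y)ᴴ * (M x * N y) = (N y)ᴴ * (∑ x, (M x)ᴴ * M x) * N y := by
            simp only [Matrix.conjTranspose_mul, Matrix.mul_sum, Matrix.sum_mul, Matrix.mul_assoc]
        _ = _ := by rw [hM1, Matrix.mul_one]
    simp only [this, hN1]

lemma cptp_iterate {d : ℕ} {E : Mat d → Mat d} (hE : IsCPTP E) (n : ℕ) : IsCPTP (E^[n]) := by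
  induction n with
  | zero => exact cptp_id
  | succ n ih => rw [Function.iterate_succ]; exact cptp_comp ih hE

lemma cptp_add {d : ℕ} {E : Mat d → Mat d} (hE : IsCPTP E) (X Y : Mat d) :
    E (X + Y) = E X + E Y := by
  obtain ⟨m, M, hM, hM1⟩ := hE
  simp only [hM, Matrix.mul_add, Matrix.add_mul, Finset.sum_add_distrib]

lemma cptp_smul {d : ℕ} {E : Mat d → Mat d} (hE : IsCPTP E) (c : ℂ) (X : Mat d) :
    E (c • X) = c • E X := by
  obtain ⟨m, M, hM, hM1⟩ := hE
  simp only [hM, Matrix.mul_smul, Matrix.smul_mul, Finset.smul_sum]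

lemma cptp_zero {d : ℕ} {E : Mat d → Mat d} (hE : IsCPTP E) : E 0 = 0 := by
  simpa using cptp_smul hE 0 0

lemma cptp_sub {d : ℕ} {E : Mat d → Mat d} (hE : IsCPTP E) (X Y : Mat d) :
    E (X - Y) = E X - E Y := by
  obtain ⟨m, M, hM, hM1⟩ := hE
  simp only [hM, Matrix.mul_sub, Matrix.sub_mul, Finset.sum_sub_distrib]

lemma cptp_sum {d : ℕ} {E : Mat d → Mat d} (hE : IsCPTP E) {ι : Type*} (s : Finset ι)
    (f : ι → Mat d) : E (∑ i ∈ s, f i) = ∑ i ∈ s, E (f i) := by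
  classical
  induction s using Finset.induction_on with
  | empty => simpa using cptp_zero hE
  | insert a s ha ih => rw [Finset.sum_insert ha, Finset.sum_insert ha, cptp_add hE, ih]

lemma cptp_trace {d : ℕ} {E : Mat d → Mat d} (hE : IsCPTP E) (X : Mat d) :
    (E X).trace = X.trace := by
  obtain ⟨m, M, hM, hM1⟩ := hE
  rw [hM, Matrix.trace_sum]
  have : ∀ k, (M k * X * (M k)ᴴ).trace = ((M k)ᴴ * M k * X).trace := fun k => by
    rw [Matrix.trace_mul_comm, Matrix.mul_assoc]
  simp only [this]
  rw [← Matrix.trace_sum, ← Matrix.sum_mul, hM1, Matrix.one_mul]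

lemma cptp_psd {d : ℕ} {E : Mat d → Mat d} (hE : IsCPTP E) {X : Mat d} (hX : X.PosSemidef) :
    (E X).PosSemidef := by
  obtain ⟨m, M, hM, hM1⟩ := hE
  rw [hM]
  exact Matrix.posSemidef_sum _ fun k _ => hX.mul_mul_conjTranspose_same _

lemma cptp_continuous {d : ℕ} {E : Mat d → Mat d} (hE : IsCPTP E) : Continuous E := by
  obtain ⟨m, M, hM, hM1⟩ := hE
  rw [funext hM]
  fun_prop

/-- Choi matrix. -/
def choi {d : ℕ} (E : Mat d → Mat d) : Matrix (Fin d × Fin d) (Fin d × Fin d) ℂ :=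
  fun p q => E (Matrix.single p.1 q.1 1) p.2 q.2

lemma choi_psd {d : ℕ} {E : Mat d → Mat d} (hE : IsCPTP E) : (choi E).PosSemidef := by
  obtain ⟨m, M, hM, hM1⟩ := hE
  have : choi E = ∑ k, Matrix.vecMulVec (fun p : Fin d × Fin d => M k p.2 p.1)
      (star (fun p : Fin d × Fin d => M k p.2 p.1)) := by
    ext p q
    simp only [choi, hM, Matrix.sum_apply, Matrix.vecMulVec_apply, Pi.star_apply]
    refine Finset.sum_congr rfl fun k _ => ?_
    rw [Matrix.mul_apply, Finset.sum_eq_single q.1]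
    · simp [Matrix.mul_single_apply_same]
    · intro b _ hb
      rw [Matrix.mul_single_apply_of_ne _ _ _ _ _ hb]; simp
    · simp
  rw [this]
  exact Matrix.posSemidef_sum _ fun k _ => Matrix.posSemidef_vecMulVec_self_star _

lemma cptp_of_choi {d : ℕ} {E : Mat d → Mat d} (hadd : ∀ X Y, E (X + Y) = E X + E Y)
    (hsmul : ∀ (c : ℂ) X, E (c • X) = c • E X) (htr : ∀ X, (E X).trace = X.trace)
    (hpsd : (choi E).PosSemidef) : IsCPTP E := by
  obtain ⟨B, hB⟩ := psd_factor hpsd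
  let M : Fin d × Fin d → Mat d := fun k => Matrix.of fun a i => star (B k (i, a))
  let L : Mat d →ₗ[ℂ] Mat d := { toFun := E, map_add' := hadd, map_smul' := hsmul }
  let L' : Mat d →ₗ[ℂ] Mat d :=
    { toFun := fun X => ∑ k, M k * X * (M k)ᴴ
      map_add' := by
        intro X Y
        simp only [Matrix.mul_add, Matrix.add_mul, Finset.sum_add_distrib]
      map_smul' := by
        intro c X
        simp only [Matrix.mul_smul, Matrix.smul_mul, Finset.smul_sum, RingHom.id_apply] }
  have hLL : L = L' := by
    apply Matrix.ext_linearMap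
    intro i j
    ext1
    ext a b
    have h1 : choi E (i, a) (j, b) = ∑ k, star (B k (i, a)) * B k (j, b) := by
      rw [hB, Matrix.mul_apply]; rfl
    have h2 : (∑ k, M k * Matrix.single i j 1 * (M k)ᴴ : Mat d) a b = ∑ k, star (B k (i, a)) * B k (j, b) := by
      rw [Matrix.sum_apply]
      refine Finset.sum_congr rfl fun k _ => ?_
      rw [Matrix.mul_apply, Finset.sum_eq_single j]
      · simp [Matrix.mul_single_apply_same, M]
      · intro b _ hb
        rw [Matrix.mul_single_apply_of_ne _ _ _ _ _ hb]; simp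
      · simp
    exact h1.trans h2.symm
  have hX : ∀ X, E X = ∑ k, M k * X * (M k)ᴴ := fun X => congrArg (fun f => f X) hLL
  refine isCPTP_of_fintype M hX ?_
  rw [Matrix.ext_iff_trace_mul_right]
  intro X
  rw [Matrix.one_mul, ← htr X, hX, Matrix.sum_mul, Matrix.trace_sum, Matrix.trace_sum]
  refine Finset.sum_congr rfl fun k _ => ?_
  rw [Matrix.trace_mul_comm (M k * X), Matrix.mul_assoc]

lemma isClosed_psd {n : Type*} [Fintype n] : IsClosed {A : Matrix n n ℂ | A.PosSemidef} := by
  have : {A : Matrix n n ℂ | A.PosSemidef} =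
      {A | Aᴴ = A} ∩ ⋂ x : n → ℂ, {A | 0 ≤ star x ⬝ᵥ (A *ᵥ x)} := by
    ext A
    simp only [Set.mem_ofPred_eq, Set.mem_inter_iff, Set.mem_iInter]
    exact Matrix.posSemidef_iff_dotProduct_mulVec
  rw [this]
  refine (isClosed_eq (by fun_prop) continuous_id).inter (isClosed_iInter fun x => ?_)
  have hc : Continuous fun A : Matrix n n ℂ => star x ⬝ᵥ (A *ᵥ x) := by fun_prop
  exact isClosed_le continuous_const hc

lemma isClosed_cptp {d : ℕ} : IsClosed {E : Mat d → Mat d | IsCPTP E} := by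
  have : {E : Mat d → Mat d | IsCPTP E} =
      (⋂ X, ⋂ Y, {E | E (X + Y) = E X + E Y}) ∩ (⋂ c : ℂ, ⋂ X, {E | E (c • X) = c • E X}) ∩
      (⋂ X, {E | (E X).trace = X.trace}) ∩ {E | (choi E).PosSemidef} := by
    ext E
    simp only [Set.mem_ofPred_eq, Set.mem_inter_iff, Set.mem_iInter]
    exact ⟨fun h => ⟨⟨⟨cptp_add h, cptp_smul h⟩, cptp_trace h⟩, choi_psd h⟩,
      fun h => cptp_of_choi h.1.1.1 h.1.1.2 h.1.2 h.2⟩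
  rw [this]
  have hev : ∀ X : Mat d, Continuous fun E : Mat d → Mat d => E X := fun X => continuous_apply X
  refine ((IsClosed.inter ?_ ?_).inter ?_).inter ?_
  · exact isClosed_iInter fun X => isClosed_iInter fun Y =>
      isClosed_eq (hev _) ((hev _).add (hev _))
  · exact isClosed_iInter fun c => isClosed_iInter fun X =>
      isClosed_eq (hev _) ((hev _).const_smul c)
  · exact isClosed_iInter fun X => isClosed_eq ((hev X).matrix_trace) continuous_const
  · refine isClosed_psd.preimage ?_
    refine continuous_matrix fun p q => ?_
    exact (hev _).matrix_elem _ _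

lemma cptp_bound {d : ℕ} {E : Mat d → Mat d} (hE : IsCPTP E) {X : Mat d} {B : ℝ}
    (hX : ∀ i j, ‖X i j‖ ≤ B) (a b : Fin d) : ‖E X a b‖ ≤ (d : ℝ) * d * B := by
  obtain ⟨m, M, hM, hM1⟩ := hE
  have hB : 0 ≤ B := (norm_nonneg _).trans (hX a a)
  have hcol : ∀ a i, ∑ k, ‖M k a i‖ ^ 2 ≤ 1 := by
    intro a i
    have h1 : ∑ k, ∑ c, ‖M k c i‖ ^ 2 = 1 := by
      have h := congrFun (congrFun hM1 i) i
      simp only [Matrix.sum_apply, Matrix.mul_apply, Matrix.conjTranspose_apply,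
        Matrix.one_apply_eq] at h
      have h' : ∀ z : ℂ, star z * z = ((‖z‖ ^ 2 : ℝ) : ℂ) := by
        intro z
        have := Complex.conj_mul' z
        push_cast
        exact this
      simp only [h'] at h
      exact_mod_cast h
    rw [← h1]
    exact Finset.sum_le_sum fun k _ =>
      Finset.single_le_sum (f := fun c => ‖M k c i‖ ^ 2) (fun c _ => by positivity)
        (Finset.mem_univ a)
  have hexp : E X a b = ∑ k, ∑ j, ∑ i, M k a i * X i j * star (M k b j) := by
    simp only [hM, Matrix.sum_apply, Matrix.mul_apply, Matrix.conjTranspose_apply, Finset.sum_mul]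
  rw [hexp]
  calc ‖∑ k, ∑ j, ∑ i, M k a i * X i j * star (M k b j)‖
      ≤ ∑ k, ∑ j, ∑ i, ‖M k a i * X i j * star (M k b j)‖ :=
        (norm_sum_le _ _).trans (Finset.sum_le_sum fun k _ => (norm_sum_le _ _).trans
          (Finset.sum_le_sum fun j _ => norm_sum_le _ _))
    _ ≤ ∑ k, ∑ j, ∑ i, B * ((‖M k a i‖ ^ 2 + ‖M k b j‖ ^ 2) / 2) := by
        refine Finset.sum_le_sum fun k _ => Finset.sum_le_sum fun j _ =>
          Finset.sum_le_sum fun i _ => ?_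
        rw [norm_mul, norm_mul, norm_star]
        have h1 : ‖M k a i‖ * ‖M k b j‖ ≤ (‖M k a i‖ ^ 2 + ‖M k b j‖ ^ 2) / 2 := by
          nlinarith [sq_nonneg (‖M k a i‖ - ‖M k b j‖)]
        calc ‖M k a i‖ * ‖X i j‖ * ‖M k b j‖ = ‖X i j‖ * (‖M k a i‖ * ‖M k b j‖) := by ring
          _ ≤ _ := mul_le_mul (hX i j) h1 (by positivity) hB
    _ = ∑ j, ∑ i, B * ((∑ k, ‖M k a i‖ ^ 2 + ∑ k, ‖M k b j‖ ^ 2) / 2) := by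
        rw [Finset.sum_comm]
        refine Finset.sum_congr rfl fun j _ => ?_
        rw [Finset.sum_comm]
        refine Finset.sum_congr rfl fun i _ => ?_
        rw [← Finset.mul_sum, ← Finset.sum_div, Finset.sum_add_distrib]
    _ ≤ ∑ j : Fin d, ∑ i : Fin d, B := by
        refine Finset.sum_le_sum fun j _ => Finset.sum_le_sum fun i _ => ?_
        have := hcol a i
        have := hcol b j
        nlinarith
    _ = (d : ℝ) * d * B := by
        simp [Finset.sum_const, nsmul_eq_mul, mul_assoc]

lemma entry_bound {d : ℕ} (X : Mat d) : ∃ B : ℝ, ∀ i j, ‖X i j‖ ≤ B := by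
  refine ⟨∑ i, ∑ j, ‖X i j‖, fun i j => ?_⟩
  exact (Finset.single_le_sum (f := fun j => ‖X i j‖) (fun _ _ => norm_nonneg _)
    (Finset.mem_univ j)).trans
    (Finset.single_le_sum (f := fun i => ∑ j, ‖X i j‖)
      (fun _ _ => Finset.sum_nonneg fun _ _ => norm_nonneg _) (Finset.mem_univ i))

lemma isCompact_cptp {d : ℕ} : IsCompact {E : Mat d → Mat d | IsCPTP E} := by
  choose B hB using fun X : Mat d => entry_bound X
  let K : Mat d → Set (Mat d) := fun X =>
    Set.pi Set.univ fun _ => Set.pi Set.univ fun _ =>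
      Metric.closedBall (0 : ℂ) ((d : ℝ) * d * B X)
  have hK : ∀ X, IsCompact (K X) := fun X =>
    isCompact_univ_pi fun _ => isCompact_univ_pi fun _ => isCompact_closedBall _ _
  refine (isCompact_univ_pi hK).of_isClosed_subset isClosed_cptp ?_
  intro E hE X _ a _ b _
  rw [mem_closedBall_zero_iff]
  exact cptp_bound hE (hB X) a b

lemma tendsto_of_entry {d : ℕ} {l : Filter ℕ} {f : ℕ → Mat d} {Y : Mat d}
    (h : ∀ a b, Tendsto (fun n => f n a b) l (nhds (Y a b))) : Tendsto f l (nhds Y) :=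
  tendsto_pi_nhds.mpr fun a => tendsto_pi_nhds.mpr fun b => h a b

/-- Cesàro averages. -/
noncomputable def ces {d : ℕ} (E : Mat d → Mat d) (n : ℕ) : Mat d → Mat d :=
  fun X => ((n + 1 : ℝ)⁻¹ : ℂ) • ∑ k ∈ Finset.range (n + 1), E^[k] X

lemma ces_cptp {d : ℕ} {E : Mat d → Mat d} (hE : IsCPTP E) (n : ℕ) : IsCPTP (ces E n) := by
  have hk := fun k => cptp_iterate hE k
  have hn : ((n : ℂ) + 1) ≠ 0 := by exact_mod_cast Nat.succ_ne_zero n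
  refine cptp_of_choi ?_ ?_ ?_ ?_
  · intro X Y
    simp only [ces, cptp_add (hk _), Finset.sum_add_distrib, smul_add]
  · intro c X
    simp only [ces, cptp_smul (hk _), ← Finset.smul_sum]
    rw [smul_comm]
  · intro X
    simp only [ces, Matrix.trace_smul, Matrix.trace_sum, cptp_trace (hk _)]
    simp [hn]
  · have : choi (ces E n) = ((n + 1 : ℝ)⁻¹ : ℂ) • ∑ k ∈ Finset.range (n + 1), choi (E^[k]) := by
      ext p q
      simp [choi, ces, Matrix.sum_apply]
    rw [this]
    refine Matrix.PosSemidef.smul (Matrix.posSemidef_sum _ fun k _ => choi_psd (hk k)) ?_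
    have : (0 : ℝ) ≤ ((n : ℝ) + 1)⁻¹ := by positivity
    exact_mod_cast this

lemma exists_cesaro {d : ℕ} {E : Mat d → Mat d} (hE : IsCPTP E) :
    ∃ C : Mat d → Mat d, IsCPTP C ∧ (∀ X, C (C X) = C X) ∧ (∀ X, C X = X ↔ E X = X) := by
  let u : Ultrafilter ℕ := Filter.hyperfilter ℕ
  have hu : (u : Filter ℕ) ≤ atTop := by
    rw [← Nat.cofinite_eq_atTop]; exact Filter.hyperfilter_le_cofinite
  obtain ⟨C, hC, hlim⟩ := isCompact_cptp.ultrafilter_le_nhds (u.map (ces E)) (by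
    rw [Filter.le_principal_iff]
    exact Filter.mem_map.mpr (Filter.univ_mem' fun n => ces_cptp hE n))
  have hl : ∀ X, Tendsto (fun n => ces E n X) u (nhds (C X)) := by
    intro X
    exact ((continuous_apply X).tendsto C).comp hlim
  have hfix : ∀ X, E X = X → ∀ n, ces E n X = X := by
    intro X hX n
    have hn : ((n : ℂ) + 1) ≠ 0 := by exact_mod_cast Nat.succ_ne_zero n
    have : ∀ k, E^[k] X = X := fun k => Function.iterate_fixed hX k
    simp only [ces, this, Finset.sum_const, Finset.card_range]
    rw [← Nat.cast_smul_eq_nsmul ℂ, smul_smul]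
    push_cast
    rw [inv_mul_cancel₀ hn, one_smul]
  have hfix' : ∀ X, E X = X → C X = X := by
    intro X hX
    have h := hl X
    simp only [hfix X hX] at h
    exact tendsto_nhds_unique h tendsto_const_nhds
  have hEC : ∀ X, E (C X) = C X := by
    intro X
    have h1 : Tendsto (fun n => E (ces E n X) - ces E n X) u (nhds (E (C X) - C X)) :=
      (((cptp_continuous hE).tendsto _).comp (hl X)).sub (hl X)
    have h2 : Tendsto (fun n => E (ces E n X) - ces E n X) atTop (nhds 0) := by
      have heq : ∀ n, E (ces E n X) - ces E n X = ((n + 1 : ℝ)⁻¹ : ℂ) • (E^[n+1] X - X) := by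
        intro n
        simp only [ces]
        rw [cptp_smul hE, cptp_sum hE, ← smul_sub, ← Finset.sum_sub_distrib]
        congr 1
        have : ∀ k, E (E^[k] X) = E^[k+1] X := fun k => (Function.iterate_succ_apply' E k X).symm
        simp only [this]
        rw [Finset.sum_range_sub (fun k => E^[k] X)]
        rfl
      simp only [heq]
      obtain ⟨B, hB⟩ := entry_bound X
      apply tendsto_of_entry
      intro a b
      have hb : ∀ n : ℕ, ‖(((n + 1 : ℝ)⁻¹ : ℂ) • (E^[n+1] X - X)) a b‖
          ≤ ((d : ℝ) * d * B + B) * (1 / ((n : ℝ) + 1)) := by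
        intro n
        rw [Matrix.smul_apply, norm_smul, Matrix.sub_apply]
        have h3 : ‖E^[n+1] X a b - X a b‖ ≤ (d : ℝ) * d * B + B :=
          (norm_sub_le _ _).trans (add_le_add (cptp_bound (cptp_iterate hE _) hB a b) (hB a b))
        have h4 : ‖((n + 1 : ℝ)⁻¹ : ℂ)‖ = 1 / ((n : ℝ) + 1) := by
          have h5 : (0 : ℝ) ≤ (n : ℝ) + 1 := by positivity
          rw [← Complex.ofReal_inv, Complex.norm_real, Real.norm_of_nonneg (by positivity), one_div]
        rw [h4, mul_comm]
        exact mul_le_mul_of_nonneg_right h3 (by positivity)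
      refine squeeze_zero_norm hb ?_
      have := (tendsto_one_div_add_atTop_nhds_zero_nat (𝕜 := ℝ)).const_mul ((d : ℝ) * d * B + B)
      simpa using this
    exact sub_eq_zero.mp (tendsto_nhds_unique h1 (h2.mono_left hu))
  refine ⟨C, hC, fun X => hfix' _ (hEC X), fun X => ⟨fun h => ?_, hfix' X⟩⟩
  rw [← h]; exact hEC X

lemma exists_idem {d : ℕ} {T : Mat d → Mat d} (hT : IsCPTP T) :
    ∃ C : Mat d → Mat d, IsCPTP C ∧ (∀ X, C (C X) = C X) ∧
      (∀ X, C X ∈ closure (Set.range fun n : ℕ => T^[n+1] X)) := by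
  let G : Set (Mat d → Mat d) := Set.range fun n : ℕ => T^[n+1]
  have hG : closure G ⊆ {E | IsCPTP E} :=
    closure_minimal (by rintro _ ⟨n, rfl⟩; exact cptp_iterate hT _) isClosed_cptp
  have hr : ∀ g : Mat d → Mat d, Continuous fun f : Mat d → Mat d => f ∘ g := fun g =>
    continuous_pi fun X => continuous_apply (g X)
  have hl : ∀ n : ℕ, ∀ g ∈ closure G, T^[n+1] ∘ g ∈ closure G := by
    intro n g hg
    have hc : Continuous fun f : Mat d → Mat d => T^[n+1] ∘ f :=
      continuous_pi fun X => (cptp_continuous (cptp_iterate hT _)).comp (continuous_apply X)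
    refine map_mem_closure hc hg ?_
    rintro _ ⟨m, rfl⟩
    refine ⟨n + 1 + m, ?_⟩
    show T^[n + 1 + m + 1] = _
    rw [add_assoc, Function.iterate_add]
  have hmul : ∀ f ∈ closure G, ∀ g ∈ closure G, f ∘ g ∈ closure G := by
    intro f hf g hg
    have h1 : closure G ⊆ {f | f ∘ g ∈ closure G} := by
      refine closure_minimal ?_ (isClosed_closure.preimage (hr g))
      rintro _ ⟨n, rfl⟩
      exact hl n g hg
    exact h1 hf
  let sg : Semigroup (Mat d → Mat d) := { mul := fun f g => f ∘ g, mul_assoc := fun _ _ _ => rfl }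
  obtain ⟨C, hC, hCC⟩ := @exists_idempotent_in_compact_subsemigroup (Mat d → Mat d) sg _ _ hr
    (closure G) ⟨_, subset_closure ⟨0, rfl⟩⟩
    (isCompact_cptp.of_isClosed_subset isClosed_closure hG) hmul
  refine ⟨C, hG hC, fun X => congrFun hCC X, fun X => ?_⟩
  refine map_mem_closure (f := fun g : Mat d → Mat d => g X) (continuous_apply X) hC ?_
  rintro _ ⟨n, rfl⟩
  exact ⟨n, rfl⟩

lemma tendsto_iterate {d : ℕ} {T C : Mat d → Mat d} (hT : IsCPTP T) (hC : IsCPTP C)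
    (hCC : ∀ X, C (C X) = C X)
    (hcl : ∀ X, C X ∈ closure (Set.range fun n : ℕ => T^[n+1] X))
    (hTC : ∀ X, T (C X) = C X) (X : Mat d) :
    Tendsto (fun n => T^[n] X) atTop (nhds (C X)) := by
  set Y := X - C X with hY
  have hCY : C Y = 0 := by rw [hY, cptp_sub hC, hCC, sub_self]
  have h0 := hcl Y
  rw [hCY] at h0
  have hYt : Tendsto (fun n => T^[n] Y) atTop (nhds 0) := by
    apply tendsto_of_entry
    intro a b
    rw [Matrix.zero_apply, Metric.tendsto_atTop]
    intro ε hε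
    have hd : (0 : ℝ) < (d : ℝ) * d + 1 := by positivity
    set δ := ε / ((d : ℝ) * d + 1) with hδ
    have hδ0 : 0 < δ := div_pos hε hd
    have hopen : IsOpen (⋂ i : Fin d, ⋂ j : Fin d, {Z : Mat d | ‖Z i j‖ < δ}) := by
      refine isOpen_iInter_of_finite fun i => isOpen_iInter_of_finite fun j => ?_
      exact isOpen_lt ((continuous_id.matrix_elem i j).norm) continuous_const
    obtain ⟨_, hZ, n, rfl⟩ := mem_closure_iff.mp h0 _ hopen (by simp [hδ0])
    simp only [Set.mem_iInter, Set.mem_ofPred_eq] at hZ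
    refine ⟨n + 1, fun m hm => ?_⟩
    obtain ⟨k, rfl⟩ := Nat.exists_eq_add_of_le' hm
    rw [Function.iterate_add_apply, dist_zero_right]
    have h1 := cptp_bound (cptp_iterate hT k) (fun i j => (hZ i j).le) a b
    have h2 : ((d : ℝ) * d + 1) * δ = ε := by rw [hδ]; field_simp
    linarith
  have hX : ∀ n, T^[n] X = T^[n] Y + C X := by
    intro n
    have h1 : T^[n] (C X) = C X := Function.iterate_fixed (hTC X) n
    have h2 : X = Y + C X := by rw [hY]; abel
    conv_lhs => rw [h2]
    rw [cptp_add (cptp_iterate hT n), h1]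
  simp only [hX]
  simpa using hYt.add_const (C X)

/-- Recurrence: a continuous Lyapunov function is constant along recurrent orbits. -/
lemma recur {d : ℕ} {T : Mat d → Mat d} {X : Mat d} {h : Mat d → ℝ} (hc : Continuous h)
    (hcl : X ∈ closure (Set.range fun n : ℕ => T^[n+1] X))
    (hmono : ∀ n, h (T^[n+1] X) ≤ h (T^[n] X)) : h X ≤ h (T X) := by
  have han : Antitone fun n => h (T^[n] X) := antitone_nat_of_succ_le hmono
  have hcl' : IsClosed {Y | h Y ≤ h (T X)} := isClosed_le hc continuous_const
  refine closure_minimal ?_ hcl' hcl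
  rintro _ ⟨n, rfl⟩
  exact han (Nat.succ_le_succ (Nat.zero_le n))

lemma sum_trace_zero {d m : ℕ} {A : Mat d} (K : Fin m → Mat d) (hA : A.PosSemidef)
    (h : ∑ k, (K k * A * (K k)ᴴ).trace = 0) (k : Fin m) : K k * A = 0 := by
  refine psd_mul_eq_zero hA ?_
  exact (Finset.sum_eq_zero_iff_of_nonneg
    (fun k _ => (hA.mul_mul_conjTranspose_same (K k)).trace_nonneg)).mp h k (Finset.mem_univ k)

lemma kraus_left {d : ℕ} {E : Mat d → Mat d} (hE : IsCPTP E) {Q : Mat d} (h : Q * E 1 = 0)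
    (X : Mat d) : Q * E X = 0 := by
  obtain ⟨m, M, hM, hM1⟩ := hE
  have h1 : ∑ k, ((Q * M k) * 1 * (Q * M k)ᴴ).trace = 0 := by
    have : ∑ k, ((Q * M k) * 1 * (Q * M k)ᴴ).trace = (Q * E 1 * Qᴴ).trace := by
      simp only [hM, Matrix.conjTranspose_mul, ← Matrix.trace_sum, Matrix.mul_sum, Matrix.sum_mul,
        Matrix.mul_assoc]
    rw [this, h]; simp
  have h2 := sum_trace_zero _ Matrix.PosSemidef.one h1
  simp only [Matrix.mul_one] at h2
  rw [hM, Matrix.mul_sum]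
  refine Finset.sum_eq_zero fun k _ => ?_
  rw [← Matrix.mul_assoc, ← Matrix.mul_assoc, h2]; simp

lemma Supp.Qherm {d : ℕ} {ρ P R : Mat d} (h : Supp ρ P R) : (1 - P)ᴴ = 1 - P := by
  simp [h.herm]

lemma Supp.Qidem {d : ℕ} {ρ P R : Mat d} (h : Supp ρ P R) : (1 - P) * (1 - P) = 1 - P := by
  simp [Matrix.mul_sub, Matrix.sub_mul, h.idem]

lemma Supp.mulR {d : ℕ} {ρ P R : Mat d} (h : Supp ρ P R) {K : Mat d} (hK : K * ρ = 0) :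
    K * P = 0 := by
  rw [← h.ρR, ← Matrix.mul_assoc, hK, Matrix.zero_mul]

lemma kraus_inv {d m : ℕ} {E : Mat d → Mat d} {M : Fin m → Mat d}
    (hM : ∀ X, E X = ∑ k, M k * X * (M k)ᴴ) {ρ P R : Mat d} (hρ : ρ.PosSemidef)
    (hs : Supp ρ P R) (hfix : E ρ = ρ) (k : Fin m) : (1 - P) * M k * P = 0 := by
  apply hs.mulR
  refine sum_trace_zero (fun k => (1 - P) * M k) hρ ?_ k
  have : ∑ k, ((1 - P) * M k * ρ * ((1 - P) * M k)ᴴ).trace = ((1 - P) * E ρ * (1 - P)ᴴ).trace := by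
    simp only [hM, Matrix.conjTranspose_mul, ← Matrix.trace_sum, Matrix.mul_sum, Matrix.sum_mul,
        Matrix.mul_assoc]
  rw [this, hfix, Matrix.sub_mul, hs.Pρ]; simp

lemma cptp_inv {d : ℕ} {E : Mat d → Mat d} (hE : IsCPTP E) {ρ P R : Mat d} (hρ : ρ.PosSemidef)
    (hs : Supp ρ P R) (hfix : E ρ = ρ) {X : Mat d} (hX : P * X = X) : P * E X = E X := by
  obtain ⟨m, M, hM, hM1⟩ := hE
  have h := kraus_inv hM hρ hs hfix
  have h0 : (1 - P) * E X = 0 := by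
    rw [hM, Matrix.mul_sum]
    refine Finset.sum_eq_zero fun k _ => ?_
    rw [← hX, ← Matrix.mul_assoc, ← Matrix.mul_assoc, ← Matrix.mul_assoc, h]; simp
  rw [Matrix.sub_mul, Matrix.one_mul, sub_eq_zero] at h0
  exact h0.symm

lemma leak_identity {d m : ℕ} {E : Mat d → Mat d} {M : Fin m → Mat d}
    (hM : ∀ X, E X = ∑ k, M k * X * (M k)ᴴ) (hM1 : ∑ k, (M k)ᴴ * M k = 1)
    {ρ P R : Mat d} (hρ : ρ.PosSemidef)
    (hs : Supp ρ P R) (hfix : E ρ = ρ) (Y : Mat d) :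
    ((1 - P) * Y).trace = ((1 - P) * E Y).trace +
      ∑ k, ((P * M k * (1 - P)) * Y * (P * M k * (1 - P))ᴴ).trace := by
  have h := kraus_inv hM hρ hs hfix
  set Q := 1 - P with hQ
  have hQh : Qᴴ = Q := hs.Qherm
  have hQQ : Q * Q = Q := hs.Qidem
  have hPQ : P + Q = 1 := by rw [hQ]; abel
  have hQM : ∀ k, Q * M k = Q * M k * Q := fun k => by
    calc Q * M k = Q * M k * (P + Q) := by rw [hPQ, Matrix.mul_one]
      _ = _ := by rw [Matrix.mul_add, h, zero_add]
  have hQM' : ∀ k, (M k)ᴴ * Q = Q * (M k)ᴴ * Q := fun k => by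
    have := congrArg Matrix.conjTranspose (hQM k)
    simpa [hQh, Matrix.mul_assoc] using this
  have key : Q = ∑ k, (M k)ᴴ * Q * M k + ∑ k, (P * M k * Q)ᴴ * (P * M k * Q) := by
    have hk : ∀ k, Q * ((M k)ᴴ * M k) * Q
        = (M k)ᴴ * Q * M k + (P * M k * Q)ᴴ * (P * M k * Q) := by
      intro k
      have e1 : (P * M k * Q)ᴴ * (P * M k * Q) = Q * (M k)ᴴ * P * M k * Q := by
        simp only [Matrix.conjTranspose_mul, hQh, hs.herm]
        calc Q * ((M k)ᴴ * P) * (P * M k * Q) = Q * (M k)ᴴ * (P * P) * M k * Q := by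
              simp only [Matrix.mul_assoc]
          _ = _ := by rw [hs.idem]
      have e2 : (M k)ᴴ * Q * M k = Q * (M k)ᴴ * Q * M k * Q := by
        calc (M k)ᴴ * Q * M k = (Q * (M k)ᴴ * Q) * M k := by rw [← hQM']
          _ = Q * (M k)ᴴ * (Q * M k) := by simp only [Matrix.mul_assoc]
          _ = Q * (M k)ᴴ * (Q * M k * Q) := by rw [← hQM]
          _ = _ := by simp only [Matrix.mul_assoc]
      rw [e1, e2, ← Matrix.add_mul, ← Matrix.add_mul, ← Matrix.mul_add, add_comm Q P, hPQ]
      simp only [Matrix.mul_assoc, Matrix.mul_one]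
    rw [← Finset.sum_add_distrib]
    simp only [← hk]
    rw [← Matrix.sum_mul, ← Matrix.mul_sum, hM1, Matrix.mul_one, hQQ]
  conv_lhs => rw [key]
  have t1 : ∀ k, ((M k)ᴴ * Q * M k * Y).trace = (Q * (M k * Y * (M k)ᴴ)).trace := fun k => by
    rw [← Matrix.mul_assoc Q, Matrix.trace_mul_comm _ (M k)ᴴ]
    simp only [Matrix.mul_assoc]
  have t2 : ∀ k, ((P * M k * Q)ᴴ * (P * M k * Q) * Y).trace
      = ((P * M k * Q) * Y * (P * M k * Q)ᴴ).trace := fun k => by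
    rw [Matrix.trace_mul_comm _ (P * M k * Q)ᴴ]
    simp only [Matrix.mul_assoc]
  rw [Matrix.add_mul, Matrix.trace_add, Matrix.sum_mul, Matrix.sum_mul, Matrix.trace_sum,
    Matrix.trace_sum, hM, Matrix.mul_sum, Matrix.trace_sum, Finset.sum_congr rfl fun k _ => t1 k,
    Finset.sum_congr rfl fun k _ => t2 k]

lemma re_le_of_add {a b c : ℂ} (h : a = b + c) (hc : 0 ≤ c) : b.re ≤ a.re := by
  have := (Complex.le_def.mp hc).1
  rw [h, Complex.add_re]; simp at this; linarith

lemma leak_le {d : ℕ} {E : Mat d → Mat d} (hE : IsCPTP E) {ρ P R : Mat d} (hρ : ρ.PosSemidef)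
    (hs : Supp ρ P R) (hfix : E ρ = ρ) {Y : Mat d} (hY : Y.PosSemidef) :
    ((1 - P) * E Y).trace.re ≤ ((1 - P) * Y).trace.re := by
  obtain ⟨m, M, hM, hM1⟩ := hE
  exact re_le_of_add (leak_identity hM hM1 hρ hs hfix Y)
    (Finset.sum_nonneg fun k _ => (hY.mul_mul_conjTranspose_same _).trace_nonneg)

lemma Supp.trace_nonneg {d : ℕ} {ρ P R : Mat d} (hs : Supp ρ P R) {Y : Mat d}
    (hY : Y.PosSemidef) : 0 ≤ ((1 - P) * Y).trace := by
  have : ((1 - P) * Y).trace = ((1 - P) * Y * (1 - P)ᴴ).trace := by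
    rw [hs.Qherm, Matrix.trace_mul_comm _ (1 - P), ← Matrix.mul_assoc, hs.Qidem]
  rw [this]
  exact (hY.mul_mul_conjTranspose_same _).trace_nonneg

lemma Supp.of_trace_zero {d : ℕ} {ρ P R : Mat d} (hs : Supp ρ P R) {Y : Mat d}
    (hY : Y.PosSemidef) (h : ((1 - P) * Y).trace = 0) : P * Y = Y := by
  have h1 : ((1 - P) * Y).trace = ((1 - P) * Y * (1 - P)ᴴ).trace := by
    rw [hs.Qherm, Matrix.trace_mul_comm _ (1 - P), ← Matrix.mul_assoc, hs.Qidem]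
  rw [h1] at h
  have h0 := psd_mul_eq_zero hY h
  rw [Matrix.sub_mul, Matrix.one_mul, sub_eq_zero] at h0
  exact h0.symm

/-- Supports increase under a CPTP projection having a faithful fixed point. -/
lemma supp_increase {d : ℕ} {E : Mat d → Mat d} (hE : IsCPTP E) (hEE : ∀ X, E (E X) = E X)
    {ρ P R : Mat d} (hρ : ρ.PosSemidef) (hs : Supp ρ P R) (hfix : E ρ = ρ)
    {Z : Mat d} (hZ : Z.PosSemidef) (hPZ : P * Z = Z) : ∃ K, Z = E Z * K := by
  have hω : (E Z).PosSemidef := cptp_psd hE hZ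
  obtain ⟨S, W, hS⟩ := exists_supp hω
  obtain ⟨m, M, hM, hM1⟩ := hE
  have hid := leak_identity hM hM1 hω hS (hEE Z)
  have h1 : ∑ k, ((S * M k * (1 - S)) * ρ * (S * M k * (1 - S))ᴴ).trace = 0 := by
    have := hid ρ
    rw [hfix] at this
    simpa using this
  have h2 : ∀ k, S * M k * (1 - S) * Z = 0 := fun k => by
    have := hs.mulR (sum_trace_zero _ hρ h1 k)
    rw [← hPZ, ← Matrix.mul_assoc, this, Matrix.zero_mul]
  have h3 : ((1 - S) * Z).trace = 0 := by
    rw [hid Z, Matrix.sub_mul 1 S, hS.Pρ]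
    simp [h2]
  have h4 := hS.of_trace_zero hZ h3
  refine ⟨W * Z, ?_⟩
  rw [← Matrix.mul_assoc, hS.ρR, h4]

/-- Compression to `P` plus dumping of the rest on `σ`. -/
noncomputable def dump {d : ℕ} (P σ : Mat d) : Mat d → Mat d :=
  fun X => P * X * P + ((1 - P) * X).trace • σ

lemma dump_cptp {d : ℕ} {ρ P R σ : Mat d} (hs : Supp ρ P R) (hσ : IsDensity σ) :
    IsCPTP (dump P σ) := by
  obtain ⟨B, hB⟩ := psd_factor hσ.1
  set Q := 1 - P with hQ
  have hQh : Qᴴ = Q := hs.Qherm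
  have hQQ : Q * Q = Q := hs.Qidem
  let N : Fin d × Fin d → Mat d := fun p => Bᴴ * Matrix.single p.1 p.2 1 * Q
  have hsum : ∀ Y : Mat d, ∑ p : Fin d × Fin d,
      (Matrix.single p.1 p.2 (1 : ℂ)) * Y * (Matrix.single p.1 p.2 (1 : ℂ))ᴴ = Y.trace • 1 := by
    intro Y
    rw [Fintype.sum_prod_type]
    simp only [Matrix.conjTranspose_single, star_one, Matrix.single_mul_mul_single, one_mul, mul_one]
    ext a b
    simp only [Matrix.sum_apply, Matrix.single_apply, Matrix.smul_apply, Matrix.one_apply,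
      Matrix.trace, Matrix.diag_apply, smul_eq_mul]
    by_cases h : a = b
    · subst h
      rw [Finset.sum_eq_single a]
      · simp
      · intro c _ hc; simp [hc]
      · simp
    · simp only [h, if_false, mul_zero]
      refine Finset.sum_eq_zero fun c _ => Finset.sum_eq_zero fun e _ => ?_
      rw [if_neg]
      rintro ⟨rfl, rfl⟩; exact h rfl
  have hsum' : ∀ Y : Mat d, ∑ p : Fin d × Fin d,
      (Matrix.single p.1 p.2 (1 : ℂ))ᴴ * Y * (Matrix.single p.1 p.2 (1 : ℂ)) = Y.trace • 1 := by
    intro Y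
    rw [← hsum Y, ← (Equiv.prodComm (Fin d) (Fin d)).sum_comp]
    refine Finset.sum_congr rfl fun p _ => ?_
    simp [Matrix.conjTranspose_single]
  refine isCPTP_of_fintype (ι := Option (Fin d × Fin d)) (fun o => o.elim P N) (fun X => ?_) ?_
  · rw [Fintype.sum_option]
    simp only [Option.elim, hs.herm, dump]
    congr 1
    calc (Q * X).trace • σ = Bᴴ * ((Q * X * Q).trace • (1 : Mat d)) * B := by
          rw [Matrix.trace_mul_comm (Q * X) Q, ← Matrix.mul_assoc, hQQ, hB]; simp
      _ = _ := by
          rw [← hsum (Q * X * Q), Matrix.mul_sum, Matrix.sum_mul]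
          refine Finset.sum_congr rfl fun p _ => ?_
          simp only [N, Matrix.conjTranspose_mul, hQh, Matrix.conjTranspose_conjTranspose,
            Matrix.mul_assoc]
  · rw [Fintype.sum_option]
    simp only [Option.elim, hs.herm, hs.idem]
    have : ∑ p, (N p)ᴴ * N p = Q := by
      calc ∑ p, (N p)ᴴ * N p = Q * (((B * Bᴴ).trace) • (1 : Mat d)) * Q := by
            rw [← hsum' (B * Bᴴ), Matrix.mul_sum, Matrix.sum_mul]
            refine Finset.sum_congr rfl fun p _ => ?_
            simp only [N, Matrix.conjTranspose_mul, hQh, Matrix.conjTranspose_conjTranspose,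
              Matrix.mul_assoc]
        _ = Q := by
            rw [Matrix.trace_mul_comm, ← hB, hσ.2]; simp [hQQ]
    rw [this, hQ]; abel

/-- The weighted quadratic form. -/
noncomputable def gq {d : ℕ} (R X : Mat d) : ℝ := (Xᴴ * R * X).trace.re

lemma gq_mono {d : ℕ} {E : Mat d → Mat d} (hE : IsCPTP E) {ρ P R : Mat d} (hρ : ρ.PosSemidef)
    (hs : Supp ρ P R) (hfix : E ρ = ρ) {X : Mat d} (hX : P * X = X) :
    gq R (E X) ≤ gq R X := by
  obtain ⟨m, M, hM, hM1⟩ := hE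
  set Z := R * E X with hZ
  have hRh : Rᴴ = R := hs.Rpsd.1
  have hZh : Zᴴ = (E X)ᴴ * R := by rw [hZ, Matrix.conjTranspose_mul, hRh]
  have hXh : Xᴴ * P = Xᴴ := by
    have := congrArg Matrix.conjTranspose hX
    simpa [hs.herm] using this
  have hEh : (E X)ᴴ = ∑ k, M k * Xᴴ * (M k)ᴴ := by
    simp only [hM, Matrix.conjTranspose_sum, Matrix.conjTranspose_mul,
      Matrix.conjTranspose_conjTranspose, Matrix.mul_assoc]
  let K : Fin m → Mat d := fun k => R * X * (M k)ᴴ - (M k)ᴴ * Z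
  have hK : ∀ k, (K k)ᴴ * ρ * K k = M k * (Xᴴ * R * X) * (M k)ᴴ - (M k * Xᴴ * (M k)ᴴ) * Z
      - Zᴴ * (M k * X * (M k)ᴴ) + Zᴴ * (M k * ρ * (M k)ᴴ) * Z := by
    intro k
    have e1 : (K k)ᴴ = M k * Xᴴ * R - Zᴴ * M k := by
      simp only [K, Matrix.conjTranspose_sub, Matrix.conjTranspose_mul,
        Matrix.conjTranspose_conjTranspose, hRh, Matrix.mul_assoc]
    rw [e1]
    calc (M k * Xᴴ * R - Zᴴ * M k) * ρ * (R * X * (M k)ᴴ - (M k)ᴴ * Z)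
        = M k * Xᴴ * (R * ρ) * R * X * (M k)ᴴ - M k * Xᴴ * (R * ρ) * (M k)ᴴ * Z
          - Zᴴ * M k * (ρ * R) * X * (M k)ᴴ + Zᴴ * (M k * ρ * (M k)ᴴ) * Z := by
          noncomm_ring
      _ = M k * (Xᴴ * P) * R * X * (M k)ᴴ - M k * (Xᴴ * P) * (M k)ᴴ * Z
          - Zᴴ * M k * (P * X) * (M k)ᴴ + Zᴴ * (M k * ρ * (M k)ᴴ) * Z := by
          rw [hs.Rρ, hs.ρR]; simp only [Matrix.mul_assoc]
      _ = _ := by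
          rw [hXh, hX]; simp only [Matrix.mul_assoc]
  have hEt := cptp_trace ⟨m, M, hM, hM1⟩ (Xᴴ * R * X)
  have htot : ∑ k, ((K k)ᴴ * ρ * K k).trace
      = (Xᴴ * R * X).trace - ((E X)ᴴ * R * E X).trace := by
    rw [← Matrix.trace_sum]
    simp only [hK, Finset.sum_add_distrib, Finset.sum_sub_distrib, ← Matrix.sum_mul,
      ← Matrix.mul_sum]
    rw [← hEh, ← hM, ← hM, ← hM, hfix, Matrix.trace_add, Matrix.trace_sub, Matrix.trace_sub, hEt]
    have e1 : (E X)ᴴ * Z = (E X)ᴴ * R * E X := by rw [hZ, Matrix.mul_assoc]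
    have e2 : Zᴴ * E X = (E X)ᴴ * R * E X := by rw [hZh]
    have e3 : Zᴴ * ρ * Z = (E X)ᴴ * R * E X := by
      rw [hZh, hZ, Matrix.mul_assoc _ R ρ, hs.Rρ, Matrix.mul_assoc _ P, ← Matrix.mul_assoc P, hs.PR,
        Matrix.mul_assoc]
    rw [e1, e2, e3]; ring
  have hnn : 0 ≤ ∑ k, ((K k)ᴴ * ρ * K k).trace :=
    Finset.sum_nonneg fun k _ => (hρ.conjTranspose_mul_mul_same _).trace_nonneg
  exact re_le_of_add (by rw [htot]; ring) hnn

lemma gq_eq {d : ℕ} {E : Mat d → Mat d} (hE : IsCPTP E) (hEE : ∀ X, E (E X) = E X)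
    {ρ P R : Mat d} (hρ : ρ.PosSemidef)
    (hs : Supp ρ P R) (hfix : E ρ = ρ) {X : Mat d} (hX : P * X = X)
    (hle : gq R X ≤ gq R (E X)) : E X = X := by
  have hPE := cptp_inv hE hρ hs hfix hX
  have h1 := gq_mono hE hρ hs hfix (X := X + E X) (by rw [Matrix.mul_add, hX, hPE])
  have h2 : gq R (E (X + E X)) = 4 * gq R (E X) := by
    rw [cptp_add hE, hEE, gq, gq]
    simp only [Matrix.conjTranspose_add, Matrix.add_mul, Matrix.mul_add, Matrix.trace_add,
      Complex.add_re]
    ring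
  have h3 : gq R (X + E X) + gq R (X - E X) = 2 * gq R X + 2 * gq R (E X) := by
    simp only [gq, Matrix.conjTranspose_add, Matrix.conjTranspose_sub, Matrix.add_mul,
      Matrix.sub_mul, Matrix.mul_sub, Matrix.mul_add, Matrix.trace_add, Matrix.trace_sub,
      Complex.add_re, Complex.sub_re]
    ring
  have h4 : gq R (X - E X) ≤ 0 := by linarith
  have hpsd := (hs.Rpsd.conjTranspose_mul_mul_same (X - E X)).trace_nonneg
  have h5 : ((X - E X)ᴴ * R * (X - E X)).trace = 0 := by
    rw [Complex.le_def] at hpsd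
    apply Complex.ext
    · exact le_antisymm h4 hpsd.1
    · exact hpsd.2.symm
  have h6 : (X - E X)ᴴ * R = 0 := psd_mul_eq_zero hs.Rpsd (by simpa using h5)
  have h7 : R * (X - E X) = 0 := by
    have := congrArg Matrix.conjTranspose h6
    simpa [hs.Rpsd.1.eq] using this
  have h8 : P * (X - E X) = 0 := by
    rw [← hs.ρR, Matrix.mul_assoc, h7, Matrix.mul_zero]
  rw [Matrix.mul_sub, hX, hPE, sub_eq_zero] at h8
  exact h8.symm

lemma gq_continuous {d : ℕ} (R : Mat d) : Continuous (gq R) := by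
  unfold gq
  exact Complex.continuous_re.comp (Continuous.matrix_trace (by fun_prop))

lemma cptp_conj {d : ℕ} {E : Mat d → Mat d} (hE : IsCPTP E) (X : Mat d) :
    E Xᴴ = (E X)ᴴ := by
  obtain ⟨m, M, hM, hM1⟩ := hE
  simp only [hM, Matrix.conjTranspose_sum, Matrix.conjTranspose_mul,
      Matrix.conjTranspose_conjTranspose, Matrix.mul_assoc]

lemma le_suppOfSet {d : ℕ} {S : Set (Mat d)} {A : Mat d} (hA : A ∈ S) (hp : A.PosSemidef) :
    LinearMap.range (Matrix.mulVecLin A) ≤ suppOfSet S :=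
  le_iSup₂_of_le (f := fun A (_ : A ∈ {A ∈ S | Matrix.PosSemidef A}) =>
    LinearMap.range (Matrix.mulVecLin A)) A ⟨hA, hp⟩ le_rfl

lemma supp_mul_of_mem {d : ℕ} {S : Set (Mat d)} {ρ P R A : Mat d} (hs : Supp ρ P R)
    (hr : LinearMap.range (Matrix.mulVecLin ρ) = suppOfSet S)
    (hA : A ∈ S) (hp : A.PosSemidef) : P * A = A := by
  refine supp_mul_of_range_le hs fun v => ?_
  rw [hr]
  exact le_suppOfSet hA hp ⟨v, rfl⟩

/-- Everything known about the `i`-th stage. -/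
structure Stage {d : ℕ} (E C : Mat d → Mat d) (ρ P R : Mat d) : Prop where
  hE : IsCPTP E
  hC : IsCPTP C
  hCC : ∀ X, C (C X) = C X
  hfix : ∀ X, C X = X ↔ E X = X
  hρ : ρ.PosSemidef
  hρE : E ρ = ρ
  hs : Supp ρ P R
  hr : LinearMap.range (Matrix.mulVecLin ρ) = suppOfSet {X | E X = X}

lemma exists_stage {d : ℕ} {E : Mat d → Mat d} (hE : IsCPTP E) :
    ∃ C ρ P R, Stage E C ρ P R := by
  obtain ⟨C, hC, hCC, hfix⟩ := exists_cesaro hE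
  obtain ⟨ρ, hρS, hρ, hr⟩ := exists_max (S := {X | E X = X}) (cptp_zero hE)
    (fun A hA B hB => by
      show E (A + B) = A + B
      rw [cptp_add hE, show E A = A from hA, show E B = B from hB])
  obtain ⟨P, R, hs⟩ := exists_supp hρ
  exact ⟨C, ρ, P, R, hE, hC, hCC, hfix, hρ, hρS, hs, hr⟩

lemma Stage.left {d : ℕ} {E C : Mat d → Mat d} {ρ P R : Mat d} (h : Stage E C ρ P R)
    {X : Mat d} (hX : E X = X) : P * X = X := by
  have h1 : P * C 1 = C 1 := supp_mul_of_mem h.hs h.hr ((h.hfix _).mp (h.hCC 1))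
    (cptp_psd h.hC Matrix.PosSemidef.one)
  have h2 : (1 - P) * C 1 = 0 := by rw [Matrix.sub_mul, h1, Matrix.one_mul, sub_self]
  have h3 := kraus_left h.hC h2 X
  rw [(h.hfix X).mpr hX, Matrix.sub_mul, Matrix.one_mul, sub_eq_zero] at h3
  exact h3.symm

lemma Stage.right {d : ℕ} {E C : Mat d → Mat d} {ρ P R : Mat d} (h : Stage E C ρ P R)
    {X : Mat d} (hX : E X = X) : X * P = X := by
  have h1 := h.left (X := Xᴴ) (by rw [cptp_conj h.hE, hX])
  have := congrArg Matrix.conjTranspose h1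
  simpa [h.hs.herm] using this

lemma dump_eq {d : ℕ} {P σ X : Mat d} (h1 : P * X = X) (h2 : X * P = X) : dump P σ X = X := by
  rw [dump, h1, h2, Matrix.sub_mul, h1]; simp

lemma Stage.map_fix {d : ℕ} {E C : Mat d → Mat d} {ρ P R : Mat d} (h : Stage E C ρ P R)
    (σ : Mat d) (X : Mat d) : C (dump P σ X) = X ↔ E X = X := by
  constructor
  · intro hX
    rw [← h.hfix, ← hX, h.hCC]
  · intro hX
    rw [dump_eq (h.left hX) (h.right hX)]
    exact (h.hfix X).mpr hX

lemma Stage.map_idem {d : ℕ} {E C : Mat d → Mat d} {ρ P R : Mat d} (h : Stage E C ρ P R)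
    (σ : Mat d) (X : Mat d) : C (dump P σ (C (dump P σ X))) = C (dump P σ X) := by
  rw [h.map_fix, ← h.hfix, h.hCC]

/-- One step of the leak estimate. -/
lemma Stage.step {d : ℕ} {E C : Mat d → Mat d} {ρ P R : Mat d} (h : Stage E C ρ P R)
    {ρ' P' R' σ : Mat d} (hρ' : ρ'.PosSemidef) (hs' : Supp ρ' P' R') (hf : E ρ' = ρ')
    (hσ : IsDensity σ) (hPσ : P' * σ = σ) {Y : Mat d} (hY : Y.PosSemidef) :
    ((1 - P') * C (dump P σ Y)).trace.re + ((1 - P) * Y).trace.re ≤ ((1 - P') * Y).trace.re := by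
  have hd : (dump P σ Y).PosSemidef := cptp_psd (dump_cptp h.hs hσ) hY
  have h1 := leak_le h.hC hρ' hs' ((h.hfix _).mpr hf) hd
  have hPP' : P * P' = P' := by
    rw [← hs'.ρR, ← Matrix.mul_assoc, h.left hf]
  have hP'P : P' * P = P' := by
    rw [← hs'.Rρ, Matrix.mul_assoc, h.right hf]
  have h2 : ((1 - P') * dump P σ Y).trace + ((1 - P) * Y).trace = ((1 - P') * Y).trace := by
    have e0 : (1 - P') * σ = 0 := by rw [Matrix.sub_mul, hPσ, Matrix.one_mul, sub_self]
    have e1 : ((1 - P') * (P * Y * P)).trace = ((P - P') * Y).trace := by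
      rw [← Matrix.mul_assoc, Matrix.trace_mul_comm, ← Matrix.mul_assoc, ← Matrix.mul_assoc]
      congr 2
      rw [Matrix.mul_sub, Matrix.sub_mul, Matrix.mul_one, h.hs.idem, hPP', hP'P]
    rw [dump, Matrix.mul_add, Matrix.mul_smul, e0, smul_zero, add_zero, e1, ← Matrix.trace_add,
      ← Matrix.add_mul]
    congr 2
    abel
  have h3 := congrArg Complex.re h2
  rw [Complex.add_re] at h3
  linarith

lemma fold_cptp {d r : ℕ} {F : Fin r → Mat d → Mat d} (hF : ∀ i, IsCPTP (F i))
    (l : List (Fin r)) : IsCPTP (fun X => l.foldl (fun y i => F i y) X) := by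
  induction l with
  | nil => exact cptp_id
  | cons i l ih => exact cptp_comp ih (hF i)

lemma fold_fix {d r : ℕ} {F : Fin r → Mat d → Mat d} {X : Mat d}
    (l : List (Fin r)) (h : ∀ i, F i X = X) : l.foldl (fun y i => F i y) X = X := by
  induction l with
  | nil => rfl
  | cons i l ih => rw [List.foldl_cons, h, ih]

lemma fold_inv {d r : ℕ} {F : Fin r → Mat d → Mat d} {P : Mat d}
    (h : ∀ i X, P * X = X → P * F i X = F i X)
    (l : List (Fin r)) : ∀ X, P * X = X → P * l.foldl (fun y i => F i y) X
      = l.foldl (fun y i => F i y) X := by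
  induction l with
  | nil => exact fun X hX => hX
  | cons i l ih => intro X hX; exact ih _ (h i X hX)

lemma fold_gq {d r : ℕ} {F : Fin r → Mat d → Mat d} (hF : ∀ i, IsCPTP (F i))
    (hFF : ∀ i X, F i (F i X) = F i X) {ρ P R : Mat d} (hρ : ρ.PosSemidef)
    (hs : Supp ρ P R) (hfix : ∀ i, F i ρ = ρ) (l : List (Fin r)) :
    ∀ X, P * X = X → gq R (l.foldl (fun y i => F i y) X) ≤ gq R X ∧
      (gq R X ≤ gq R (l.foldl (fun y i => F i y) X) → ∀ i ∈ l, F i X = X) := by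
  induction l with
  | nil => intro X hX; simp
  | cons i l ih =>
    intro X hX
    have hPF := cptp_inv (hF i) hρ hs (hfix i) hX
    have h1 := gq_mono (hF i) hρ hs (hfix i) hX
    obtain ⟨h2, h3⟩ := ih _ hPF
    rw [List.foldl_cons]
    refine ⟨h2.trans h1, fun hle => ?_⟩
    have h4 : F i X = X := gq_eq (hF i) (hFF i) hρ hs (hfix i) hX (hle.trans h2)
    rw [h4] at h3 hle
    intro j hj
    rcases List.mem_cons.mp hj with rfl | hj
    · exact h4
    · exact h3 hle j hj

lemma fold_leak {d r : ℕ} {E C : Fin r → Mat d → Mat d} {ρ P R : Fin r → Mat d}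
    (h : ∀ i, Stage (E i) (C i) (ρ i) (P i) (R i))
    {ρ' P' R' σ : Mat d} (hρ' : ρ'.PosSemidef) (hs' : Supp ρ' P' R') (hf : ∀ i, E i ρ' = ρ')
    (hσ : IsDensity σ) (hPσ : P' * σ = σ) (l : List (Fin r)) :
    ∀ Y : Mat d, Y.PosSemidef →
      ((1 - P') * l.foldl (fun y i => C i (dump (P i) σ y)) Y).trace.re
        ≤ ((1 - P') * Y).trace.re ∧
      (((1 - P') * Y).trace.re ≤
        ((1 - P') * l.foldl (fun y i => C i (dump (P i) σ y)) Y).trace.re →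
        ∀ i ∈ l, P i * Y = Y) := by
  induction l with
  | nil => intro X hX; simp
  | cons i l ih =>
    intro Y hY
    have hFY : (C i (dump (P i) σ Y)).PosSemidef :=
      cptp_psd (h i).hC (cptp_psd (dump_cptp (h i).hs hσ) hY)
    have h1 := (h i).step hρ' hs' (hf i) hσ hPσ hY
    have h0 := (h i).hs.trace_nonneg hY
    have h0r : 0 ≤ ((1 - P i) * Y).trace.re := (Complex.le_def.mp h0).1
    obtain ⟨h2, h3⟩ := ih _ hFY
    rw [List.foldl_cons]
    refine ⟨by linarith, fun hle => ?_⟩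
    have h4 : ((1 - P i) * Y).trace = 0 := by
      apply Complex.ext
      · exact le_antisymm (by simp only [Complex.zero_re]; linarith) h0r
      · exact (Complex.le_def.mp h0).2.symm
    have h5 := (h i).hs.of_trace_zero hY h4
    have h6 : Y * P i = Y := by
      have := congrArg Matrix.conjTranspose h5
      simpa [(h i).hs.herm, hY.1.eq] using this
    have h7 := h3 (by linarith)
    rw [dump_eq h5 h6] at h7
    obtain ⟨K, hK⟩ := supp_increase (h i).hC (h i).hCC (h i).hρ (h i).hs
      (((h i).hfix _).mpr (h i).hρE) hY h5
    intro j hj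
    rcases List.mem_cons.mp hj with rfl | hj
    · exact h5
    · calc P j * Y = P j * (C i Y * K) := by rw [← hK]
        _ = C i Y * K := by rw [← Matrix.mul_assoc, h7 j hj]
        _ = Y := hK.symm

lemma cycleOf_eq {d r : ℕ} (F : Fin r → Mat d → Mat d) :
    cycleOf F = fun X => (List.finRange r).foldl (fun y i => F i y) X := by
  funext X
  rw [cycleOf, List.ofFn_eq_map, List.foldl_map]

end FPS

open FPS in
/-- General fixed-point set stabilization: if the fixed-point sets `A i = fix(E i)` of CPTP
maps have intersection `Â` containing a density matrix and satisfying
`supp(Â) = ⋂ i, supp(A i)`, then there exist CPTP projections `Ê i` onto the `A i` whose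
cyclic iterates converge, on every density matrix, to a CPTP projection onto `Â`. -/
theorem general_fixed_point_set_stabilization {d r : ℕ}
    (E : Fin r → (Matrix (Fin d) (Fin d) ℂ → Matrix (Fin d) (Fin d) ℂ))
    (hE : ∀ i, IsCPTP (E i))
    (hne : ∃ σ, IsDensity σ ∧ ∀ i, E i σ = σ)
    (hsupp : suppOfSet {X | ∀ i, E i X = X} = ⨅ i, suppOfSet {X | E i X = X}) :
    ∃ Ei : Fin r → (Matrix (Fin d) (Fin d) ℂ → Matrix (Fin d) (Fin d) ℂ),
      (∀ i, IsCPTP (Ei i) ∧ (∀ X, Ei i (Ei i X) = Ei i X) ∧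
        (∀ X, Ei i X = X ↔ E i X = X)) ∧
      ∃ Ehat : Matrix (Fin d) (Fin d) ℂ → Matrix (Fin d) (Fin d) ℂ,
        IsCPTP Ehat ∧ (∀ X, Ehat (Ehat X) = Ehat X) ∧
        (∀ X, Ehat X = X ↔ ∀ i, E i X = X) ∧
        ∀ τ, IsDensity τ →
          Tendsto (fun n : ℕ => (cycleOf Ei)^[n] τ) atTop (nhds (Ehat τ)) := by
  choose C ρ P R hS using fun i => exists_stage (hE i)
  obtain ⟨σ, hσ, hσE⟩ := hne
  obtain ⟨ρ', hρ'S, hρ', hr'⟩ := exists_max (S := {X | ∀ i, E i X = X})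
    (fun i => cptp_zero (hE i)) (fun A hA B hB i => by rw [cptp_add (hE i), hA i, hB i])
  have hρ'E : ∀ i, E i ρ' = ρ' := hρ'S
  obtain ⟨P', R', hs'⟩ := exists_supp hρ'
  have hPσ : P' * σ = σ := supp_mul_of_mem hs' hr' hσE hσ.1
  let F : Fin r → (Matrix (Fin d) (Fin d) ℂ → Matrix (Fin d) (Fin d) ℂ) :=
    fun i X => C i (dump (P i) σ X)
  have hF : ∀ i, IsCPTP (F i) := fun i => cptp_comp (hS i).hC (dump_cptp (hS i).hs hσ)
  have hFF : ∀ i X, F i (F i X) = F i X := fun i X => (hS i).map_idem σ X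
  have hFfix : ∀ i X, F i X = X ↔ E i X = X := fun i X => (hS i).map_fix σ X
  refine ⟨F, fun i => ⟨hF i, hFF i, hFfix i⟩, ?_⟩
  set T := cycleOf F with hTdef
  have hTeq : T = fun X => (List.finRange r).foldl (fun y i => F i y) X := cycleOf_eq F
  have hT : IsCPTP T := by rw [hTeq]; exact fold_cptp hF _
  obtain ⟨Q, hQ, hQQ, hcl⟩ := exists_idem hT
  have hrec : ∀ X, Q X ∈ closure (Set.range fun n : ℕ => T^[n+1] (Q X)) := fun X => by
    have := hcl (Q X)
    rwa [hQQ] at this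
  -- the support of the recurrent part
  have hQ1 : (Q 1).PosSemidef := cptp_psd hQ Matrix.PosSemidef.one
  have hleak := fold_leak hS hρ' hs' hρ'E hσ hPσ (List.finRange r)
  have hP1 : ∀ i, P i * Q 1 = Q 1 := by
    have h1 := recur (T := T) (X := Q 1) (h := fun Y => ((1 - P') * Y).trace.re)
      (Complex.continuous_re.comp (Continuous.matrix_trace (by fun_prop))) (hrec 1) (fun n => by
        rw [Function.iterate_succ_apply']
        have := (hleak _ (cptp_psd (cptp_iterate hT n) hQ1)).1
        rw [hTeq] at this ⊢
        exact this)
    intro i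
    refine (hleak _ hQ1).2 ?_ i (List.mem_finRange i)
    rw [hTeq] at h1
    exact h1
  have hP'1 : P' * Q 1 = Q 1 := by
    refine supp_mul_of_range_le hs' fun v => ?_
    rw [hr', hsupp, Submodule.mem_iInf]
    intro i
    rw [← (hS i).hr]
    exact range_of_supp_mul (hS i).hs (hP1 i) v
  have hP'Q : ∀ X, P' * Q X = Q X := fun X => by
    have h1 : (1 - P') * Q 1 = 0 := by rw [Matrix.sub_mul, hP'1, Matrix.one_mul, sub_self]
    have h2 := kraus_left hQ h1 X
    rw [Matrix.sub_mul, Matrix.one_mul, sub_eq_zero] at h2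
    exact h2.symm
  -- recurrent points are fixed
  have hFρ' : ∀ i, F i ρ' = ρ' := fun i => (hFfix i _).mpr (hρ'E i)
  have hgq := fold_gq hF hFF hρ' hs' hFρ' (List.finRange r)
  have hTρ' : T ρ' = ρ' := by rw [hTeq]; exact fold_fix _ hFρ'
  have hFQ : ∀ X i, F i (Q X) = Q X := by
    intro X
    have h1 := recur (T := T) (X := Q X) (h := gq R') (gq_continuous R') (hrec X) (fun n => by
      rw [Function.iterate_succ_apply']
      have := (hgq _ (cptp_inv (cptp_iterate hT n) hρ' hs' (Function.iterate_fixed hTρ' n)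
        (hP'Q X))).1
      rw [hTeq] at this ⊢
      exact this)
    intro i
    refine (hgq _ (hP'Q X)).2 ?_ i (List.mem_finRange i)
    rw [hTeq] at h1
    exact h1
  have hTfix : ∀ X, (∀ i, F i X = X) → T X = X := fun X h => by rw [hTeq]; exact fold_fix _ h
  refine ⟨Q, hQ, hQQ, fun X => ⟨fun hX i => ?_, fun hX => ?_⟩, fun τ _ => ?_⟩
  · rw [← hFfix, ← hX, hFQ]
  · have h1 : T X = X := hTfix X fun i => (hFfix i X).mpr (hX i)
    have h2 := hcl X
    have h3 : (Set.range fun n : ℕ => T^[n+1] X) = {X} := by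
      have : (fun n : ℕ => T^[n+1] X) = fun _ => X :=
        funext fun n => Function.iterate_fixed h1 (n + 1)
      rw [this, Set.range_const]
    rw [h3, closure_singleton] at h2
    exact h2
  · exact tendsto_iterate hT hQ hQQ hcl (fun X => hTfix _ (hFQ X)) τ
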